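/- arXiv:2603.16833 — 2 statements merged into one kernel-verified Lean document; each statement's English description precedes it below -/
import Mathlib

section
/- Outcome-side robustness of the nested augmented functional (mechanism behind Corollary 5(d)'s point consistency): under consistency, ignorability, surrogate-mediated MAR, treatment positivity, and censoring support positivity, define m₁ := E[A·Q̄ | 𝔴] / e. Then for every bounded 𝔪-measurable random variable H₁ and every bounded 𝔴-measurable random variable H₂, E[H₁ · A · Δ · (Y − Q̄) + H₂ · A · (Q̄ − m₁) + m₁] = E[Y(1)]; correct outcome and intermediate regressions recover the estimand under arbitrary (possibly misspecified) propensity weights. -/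
open MeasureTheory ProbabilityTheory

/-- Conditional expectations factor over products of conditionally independent integrable
real random variables. -/
lemma ProbabilityTheory.CondIndepFun.condExp_mul {Ω : Type*} {m mΩ : MeasurableSpace Ω}
    [StandardBorelSpace Ω] {μ : Measure Ω} [IsFiniteMeasure μ] (hm : m ≤ mΩ) {f g : Ω → ℝ}
    (hfg : CondIndepFun m hm f g μ) (hf : Measurable f) (hg : Measurable g)
    (hfi : Integrable f μ) (hgi : Integrable g μ) (hfgi : Integrable (f * g) μ) :
    μ[f * g | m] =ᵐ[μ] μ[f | m] * μ[g | m] := by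
  have h := ae_of_ae_trim hm ((condIndepFun_iff_map_prod_eq_prod_map_map hf hg).1 hfg)
  filter_upwards [h, condExp_ae_eq_integral_condExpKernel hm hfi,
    condExp_ae_eq_integral_condExpKernel hm hgi,
    condExp_ae_eq_integral_condExpKernel hm hfgi] with ω hω h₁ h₂ h₃
  rw [Kernel.map_apply _ (hf.prodMk hg), Kernel.prod_apply, Kernel.map_apply _ hf,
    Kernel.map_apply _ hg] at hω
  have hind : IndepFun f g (condExpKernel μ m ω) :=
    (indepFun_iff_map_prod_eq_prod_map_map hf.aemeasurable hg.aemeasurable).2 hω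
  rw [Pi.mul_apply, h₁, h₂, h₃]
  exact hind.integral_mul_eq_mul_integral hf.aestronglyMeasurable hg.aestronglyMeasurable

/-- A function with vanishing conditional expectation given `m` is orthogonal to every bounded
`m`-measurable weight. -/
lemma integral_mul_eq_zero_of_condExp_ae_eq_zero {Ω : Type*} {m mΩ : MeasurableSpace Ω}
    {μ : Measure Ω} [IsFiniteMeasure μ] (hm : m ≤ mΩ) {h f : Ω → ℝ}
    (hh : Measurable[m] h) {C : ℝ} (hC : ∀ ω, |h ω| ≤ C) (hf : Integrable f μ)
    (hf0 : μ[f | m] =ᵐ[μ] 0) :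
    ∫ ω, h ω * f ω ∂μ = 0 := by
  have h₁ := condExp_stronglyMeasurable_mul_of_bound hm hh.stronglyMeasurable hf C
    (ae_of_all _ hC)
  calc ∫ ω, h ω * f ω ∂μ = ∫ ω, (μ[h * f | m]) ω ∂μ := (integral_condExp hm).symm
    _ = ∫ _, (0 : ℝ) ∂μ := integral_congr_ae <| by
        filter_upwards [h₁, hf0] with ω h₂ h₃
        simp [h₂, h₃]
    _ = 0 := integral_zero _ _

/-- **Outcome-side robustness of the nested augmented functional** (mechanism behind
Corollary 5(d)'s point consistency).  With `𝔪 := σ(S, A, W)`, `𝔴 := σ(W)`, `gΔ` a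
version of `E[Δ | 𝔪]`, `e` a version of `E[A | 𝔴]`, `Qbar := E[Δ·Y | 𝔪] / gΔ` and
`m₁ := E[A·Qbar | 𝔴] / e`, under consistency, ignorability, surrogate-mediated MAR,
treatment positivity and censoring support positivity, for every bounded
`𝔪`-measurable `H₁` and every bounded `𝔴`-measurable `H₂`,
`E[H₁·A·Δ·(Y − Qbar) + H₂·A·(Qbar − m₁) + m₁] = E[Y(1)]`: correct outcome and intermediate
regressions recover the estimand under arbitrary (possibly misspecified) propensity
weights. -/
theorem outcome_side_robustness
    {Ω : Type*} [mΩ : MeasurableSpace Ω] [StandardBorelSpace Ω]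
    {P : Measure Ω} [IsProbabilityMeasure P] {p : ℕ}
    (W : Ω → (Fin p → ℝ)) (A S Δ Y Y0 Y1 : Ω → ℝ)
    (hW : Measurable W) (hA : Measurable A) (hS : Measurable S)
    (hΔ : Measurable Δ) (hY : Measurable Y)
    (hY0 : Measurable Y0) (hY1 : Measurable Y1)
    (hA01 : ∀ ω, A ω = 0 ∨ A ω = 1) (hΔ01 : ∀ ω, Δ ω = 0 ∨ Δ ω = 1)
    (𝔪 𝔴 : MeasurableSpace Ω)
    (h𝔪 : 𝔪 = MeasurableSpace.comap (fun ω => (S ω, A ω, W ω)) inferInstance)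
    (h𝔴 : 𝔴 = MeasurableSpace.comap W inferInstance)
    (h𝔪le : 𝔪 ≤ mΩ) (h𝔴le : 𝔴 ≤ mΩ)
    -- consistency
    (hcons : ∀ ω, Y ω = A ω * Y1 ω + (1 - A ω) * Y0 ω)
    -- ignorability
    (hign : CondIndepFun 𝔴 h𝔴le A (fun ω => (Y0 ω, Y1 ω)) P)
    -- surrogate-mediated MAR
    (hMAR : CondIndepFun 𝔪 h𝔪le Δ Y P)
    (hY0int : Integrable Y0 P) (hY1int : Integrable Y1 P) (hYint : Integrable Y P)
    (gΔ : Ω → ℝ) (hgΔ : gΔ =ᵐ[P] P[Δ | 𝔪])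
    (e : Ω → ℝ) (he : e =ᵐ[P] P[A | 𝔴])
    -- treatment positivity
    (cA : ℝ) (hcA : 0 < cA) (hepos : ∀ᵐ ω ∂P, cA ≤ e ω ∧ e ω ≤ 1 - cA)
    -- censoring support positivity
    (cΔ : ℝ) (hcΔ : 0 < cΔ) (hgΔpos : ∀ᵐ ω ∂P, cΔ ≤ gΔ ω)
    -- the observed-data outcome regression and the intermediate regression
    (Qbar : Ω → ℝ) (hQbar : Qbar = fun ω => (P[fun ω' => Δ ω' * Y ω' | 𝔪]) ω / gΔ ω)
    (m₁ : Ω → ℝ) (hm₁ : m₁ = fun ω => (P[fun ω' => A ω' * Qbar ω' | 𝔴]) ω / e ω)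
    -- arbitrary bounded weights
    (H₁ : Ω → ℝ) (hH₁meas : Measurable[𝔪] H₁) (C₁ : ℝ) (hH₁bd : ∀ ω, |H₁ ω| ≤ C₁)
    (H₂ : Ω → ℝ) (hH₂meas : Measurable[𝔴] H₂) (C₂ : ℝ) (hH₂bd : ∀ ω, |H₂ ω| ≤ C₂) :
    ∫ ω, H₁ ω * A ω * Δ ω * (Y ω - Qbar ω) + H₂ ω * A ω * (Qbar ω - m₁ ω) + m₁ ω ∂P
      = ∫ ω, Y1 ω ∂P := by
  have h𝔴𝔪 : 𝔴 ≤ 𝔪 := by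
    rw [h𝔴, h𝔪]
    exact Measurable.comap_le
      ((measurable_snd.comp measurable_snd).comp (comap_measurable fun ω => (S ω, A ω, W ω)))
  have hA𝔪 : Measurable[𝔪] A := by
    rw [h𝔪]
    exact (measurable_fst.comp measurable_snd).comp
      (comap_measurable fun ω => (S ω, A ω, W ω))
  have hA1 : ∀ ω, ‖A ω‖ ≤ 1 := fun ω => by rcases hA01 ω with h | h <;> simp [h]
  have hΔ1 : ∀ ω, ‖Δ ω‖ ≤ 1 := fun ω => by rcases hΔ01 ω with h | h <;> simp [h]
  have hAint : Integrable A P :=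
    Integrable.of_bound hA.aestronglyMeasurable 1 (ae_of_all _ hA1)
  have hΔint : Integrable Δ P :=
    Integrable.of_bound hΔ.aestronglyMeasurable 1 (ae_of_all _ hΔ1)
  have hA_mul {f : Ω → ℝ} (hf : Integrable f P) : Integrable (A * f) P :=
    hf.bdd_mul hA.aestronglyMeasurable (ae_of_all _ hA1)
  have hΔ_mul {f : Ω → ℝ} (hf : Integrable f P) : Integrable (Δ * f) P :=
    hf.bdd_mul hΔ.aestronglyMeasurable (ae_of_all _ hΔ1)
  set q : Ω → ℝ := P[Y | 𝔪]
  set r : Ω → ℝ := P[Y1 | 𝔴] with hr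
  have hqint : Integrable q P := integrable_condExp
  have hrint : Integrable r P := integrable_condExp
  have hΔY : P[Δ * Y | 𝔪] =ᵐ[P] P[Δ | 𝔪] * q :=
    hMAR.condExp_mul h𝔪le hΔ hY hΔint hYint (hΔ_mul hYint)
  have hQq : Qbar =ᵐ[P] q := by
    filter_upwards [hΔY, hgΔ, hgΔpos] with ω h₁ h₂ h₃
    have h₄ : (P[fun ω' => Δ ω' * Y ω' | 𝔪]) ω = gΔ ω * q ω := by rw [h₂]; exact h₁
    have h₅ : gΔ ω ≠ 0 := (hcΔ.trans_le h₃).ne'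
    rw [hQbar]
    simp only [h₄]
    field_simp
  have hAY : A * Y = A * Y1 := by
    funext ω
    rcases hA01 ω with h | h <;> simp [hcons ω, h]
  have hAq : P[A * q | 𝔴] =ᵐ[P] P[A | 𝔴] * r := by
    have h₁ : P[A * Y | 𝔪] =ᵐ[P] A * q :=
      condExp_stronglyMeasurable_mul_of_bound h𝔪le hA𝔪.stronglyMeasurable hYint 1
        (ae_of_all _ hA1)
    have h₂ : P[A * Y1 | 𝔴] =ᵐ[P] P[A | 𝔴] * r :=
      (hign.comp measurable_id measurable_snd).condExp_mul h𝔴le hA hY1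
        hAint hY1int (hA_mul hY1int)
    calc P[A * q | 𝔴] =ᵐ[P] P[P[A * Y | 𝔪] | 𝔴] := condExp_congr_ae h₁.symm
      _ =ᵐ[P] P[A * Y | 𝔴] := condExp_condExp_of_le h𝔴𝔪 h𝔪le
      _ =ᵐ[P] P[A | 𝔴] * r := by rw [hAY]; exact h₂
  have hm₁r : m₁ =ᵐ[P] r := by
    have h₀ : P[fun ω' => A ω' * Qbar ω' | 𝔴] =ᵐ[P] P[A * q | 𝔴] :=
      condExp_congr_ae (by filter_upwards [hQq] with ω h; simp [h])
    filter_upwards [h₀, hAq, he, hepos] with ω h₁ h₂ h₃ h₄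
    have h₅ : e ω ≠ 0 := (hcA.trans_le h₄.1).ne'
    rw [hm₁]
    simp only [h₁, h₂, Pi.mul_apply, ← h₃]
    field_simp
  have hres₁ : P[Δ * Y - Δ * q | 𝔪] =ᵐ[P] 0 := by
    have h := condExp_mul_of_stronglyMeasurable_right
      (stronglyMeasurable_condExp : StronglyMeasurable[𝔪] q) (hΔ_mul hqint) hΔint
    filter_upwards [condExp_sub (hΔ_mul hYint) (hΔ_mul hqint) 𝔪, h, hΔY] with ω h₁ h₂ h₃
    rw [h₁, Pi.sub_apply, h₂, h₃, sub_self, Pi.zero_apply]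
  have hres₂ : P[A * q - A * r | 𝔴] =ᵐ[P] 0 := by
    have h := condExp_mul_of_stronglyMeasurable_right
      (stronglyMeasurable_condExp : StronglyMeasurable[𝔴] r) (hA_mul hrint) hAint
    filter_upwards [condExp_sub (hA_mul hqint) (hA_mul hrint) 𝔴, h, hAq] with ω h₁ h₂ h₃
    rw [h₁, Pi.sub_apply, h₂, h₃, sub_self, Pi.zero_apply]
  have hint₁ : Integrable (Δ * Y - Δ * q) P := (hΔ_mul hYint).sub (hΔ_mul hqint)
  have hint₂ : Integrable (A * q - A * r) P := (hA_mul hqint).sub (hA_mul hrint)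
  have hH₁A : Measurable[𝔪] fun ω => H₁ ω * A ω := hH₁meas.mul hA𝔪
  have hH₁A_bd : ∀ ω, |H₁ ω * A ω| ≤ C₁ := fun ω => by
    rw [abs_mul]
    exact (mul_le_of_le_one_right (abs_nonneg _) (hA1 ω)).trans (hH₁bd ω)
  have hI₁ := hint₁.bdd_mul (hH₁A.mono h𝔪le le_rfl).aestronglyMeasurable
    (ae_of_all P hH₁A_bd)
  have hI₂ := hint₂.bdd_mul (hH₂meas.mono h𝔴le le_rfl).aestronglyMeasurable
    (ae_of_all P hH₂bd)
  calc ∫ ω, H₁ ω * A ω * Δ ω * (Y ω - Qbar ω) + H₂ ω * A ω * (Qbar ω - m₁ ω) + m₁ ω ∂P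
      = ∫ ω, H₁ ω * A ω * (Δ * Y - Δ * q) ω + H₂ ω * (A * q - A * r) ω + r ω ∂P :=
        integral_congr_ae <| by
          filter_upwards [hQq, hm₁r] with ω h₁ h₂
          simp only [h₁, h₂, Pi.sub_apply, Pi.mul_apply]
          ring
    _ = ∫ ω, H₁ ω * A ω * (Δ * Y - Δ * q) ω ∂P + ∫ ω, H₂ ω * (A * q - A * r) ω ∂P
          + ∫ ω, r ω ∂P := by
        rw [integral_add (by exact hI₁.add hI₂) hrint, integral_add hI₁ hI₂]
    _ = ∫ ω, Y1 ω ∂P := by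
        rw [integral_mul_eq_zero_of_condExp_ae_eq_zero h𝔪le hH₁A hH₁A_bd hint₁ hres₁,
          integral_mul_eq_zero_of_condExp_ae_eq_zero h𝔴le hH₂meas hH₂bd hint₂ hres₂,
          hr, integral_condExp h𝔴le, zero_add, zero_add]
end

section
/- Propensity-side robustness of the nested augmented functional (mechanism behind Corollary 5(c)): under consistency, ignorability, surrogate-mediated MAR, treatment positivity, and censoring support positivity, for every bounded σ(S, W)-measurable random variable Q̂ and every bounded 𝔴-measurable random variable m̂, E[(A·Δ) / (e·gΔ) · (Y − Q̂) + (A / e) · (Q̂ − m̂) + m̂] = E[Y(1)]; with the true treatment and censoring propensities, the augmented functional returns the estimand for arbitrary (possibly misspecified) outcome and intermediate models. -/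
open MeasureTheory ProbabilityTheory

/-- Conditional expectation is multiplicative on conditionally independent variables. -/
theorem condExp_mul_of_condIndepFun {Ω : Type*} {m mΩ : MeasurableSpace Ω} [StandardBorelSpace Ω]
    {P : Measure Ω} [IsFiniteMeasure P] (hm : m ≤ mΩ) {X Z : Ω → ℝ}
    (hX : Measurable X) (hZ : Measurable Z) (hXZ : CondIndepFun m hm X Z P)
    (hXint : Integrable X P) (hZint : Integrable Z P) (hint : Integrable (X * Z) P) :
    P[X * Z | m] =ᵐ[P] P[X | m] * P[Z | m] := by
  have h := (condIndepFun_iff_map_prod_eq_prod_map_map hX hZ).1 hXZ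
  filter_upwards [ae_of_ae_trim hm h, condExp_ae_eq_integral_condExpKernel hm hint,
    condExp_ae_eq_integral_condExpKernel hm hXint,
    condExp_ae_eq_integral_condExpKernel hm hZint] with ω h1 h2 h3 h4
  rw [Pi.mul_apply, h2, h3, h4]
  have hind : IndepFun X Z (condExpKernel P m ω) := by
    rw [indepFun_iff_map_prod_eq_prod_map_map hX.aemeasurable hZ.aemeasurable]
    rwa [Kernel.map_apply _ (hX.prodMk hZ), Kernel.prod_apply, Kernel.map_apply _ hX,
      Kernel.map_apply _ hZ] at h1
  exact hind.integral_mul_eq_mul_integral hX.aestronglyMeasurable hZ.aestronglyMeasurable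

/-- Bound on a quotient from an upper bound on its numerator and a positive lower bound on its
denominator. -/
theorem norm_div_le_div_of_le_of_le {a b c C : ℝ} (hc : 0 < c) (hb : c ≤ b) (ha : ‖a‖ ≤ C) :
    ‖a / b‖ ≤ C / c := by
  rw [norm_div, Real.norm_of_nonneg (hc.le.trans hb)]
  exact div_le_div₀ ((norm_nonneg _).trans ha) ha hc hb

/-- Inverse weighting by the conditional mean `p` of `X` given `m` has no effect on the mean of
the product of a bounded `m`-measurable variable and one that is conditionally independent
of `X`. -/
theorem integral_inverse_weighting {Ω : Type*} {m mΩ : MeasurableSpace Ω} [StandardBorelSpace Ω]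
    {P : Measure Ω} [IsFiniteMeasure P] (hm : m ≤ mΩ) {X Z p h : Ω → ℝ}
    (hX : Measurable X) (hZ : Measurable Z) (hXZ : CondIndepFun m hm X Z P)
    {B c C : ℝ} (hXbd : ∀ ω, ‖X ω‖ ≤ B) (hZint : Integrable Z P)
    (hp : p =ᵐ[P] P[X | m]) (hc : 0 < c) (hcp : ∀ᵐ ω ∂P, c ≤ p ω)
    (hh : AEStronglyMeasurable[m] h P) (hC : ∀ᵐ ω ∂P, ‖h ω‖ ≤ C) :
    Integrable (fun ω => X ω / p ω * (h ω * Z ω)) P ∧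
      ∫ ω, X ω / p ω * (h ω * Z ω) ∂P = ∫ ω, h ω * Z ω ∂P := by
  have hpm : AEStronglyMeasurable[m] p P :=
    stronglyMeasurable_condExp.aestronglyMeasurable.congr hp.symm
  have hk : AEStronglyMeasurable[m] (fun ω => h ω / p ω) P :=
    hh.div₀ hpm
  have hkbd : ∀ᵐ ω ∂P, ‖h ω / p ω‖ ≤ C / c := by
    filter_upwards [hcp, hC] with ω h1 h2 using norm_div_le_div_of_le_of_le hc h1 h2
  have hXint : Integrable X P := .of_bound hX.aestronglyMeasurable B (ae_of_all _ hXbd)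
  have hXZint : Integrable (X * Z) P :=
    hZint.bdd_mul hX.aestronglyMeasurable (ae_of_all _ hXbd)
  have hkXZ := hXZint.bdd_mul (hk.mono hm) hkbd
  have hhZ : Integrable (fun ω => h ω * Z ω) P := hZint.bdd_mul (hh.mono hm) hC
  have hrw : (fun ω => X ω / p ω * (h ω * Z ω)) = fun ω => h ω / p ω * (X * Z) ω := by
    ext ω
    simp only [Pi.mul_apply]
    ring
  rw [hrw]
  refine ⟨hkXZ, ?_⟩
  rw [← integral_condExp hm, ← integral_condExp (f := fun ω => h ω * Z ω) hm]
  refine integral_congr_ae ?_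
  filter_upwards [condExp_mul_of_aestronglyMeasurable_left hk hkXZ hXZint,
    condExp_mul_of_condIndepFun hm hX hZ hXZ hXint hZint hXZint,
    condExp_mul_of_aestronglyMeasurable_left hh hhZ hZint, hp, hcp] with ω h1 h2 h3 h4 h5
  have hne : p ω ≠ 0 := (hc.trans_le h5).ne'
  refine h1.trans (Eq.trans ?_ h3.symm)
  rw [Pi.mul_apply, Pi.mul_apply, h2, Pi.mul_apply, ← h4]
  field_simp

/-- **Propensity-side robustness of the nested augmented functional** (mechanism
behind Corollary 5(c)).  With `𝔪 := σ(S, A, W)`, `𝔴 := σ(W)`, `gΔ` a version of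
`E[Δ | 𝔪]` and `e` a version of `E[A | 𝔴]`, under consistency, ignorability,
surrogate-mediated MAR, treatment positivity and censoring support positivity, for
every bounded `σ(S, W)`-measurable `Q̂` and every bounded `𝔴`-measurable `m̂`,
`E[(A·Δ)/(e·gΔ)·(Y − Q̂) + (A/e)·(Q̂ − m̂) + m̂] = E[Y(1)]`: with the true treatment
and censoring propensities, the augmented functional returns the estimand for
arbitrary (possibly misspecified) outcome and intermediate models. -/
theorem propensity_side_robustness
    {Ω : Type*} [mΩ : MeasurableSpace Ω] [StandardBorelSpace Ω]
    {P : Measure Ω} [IsProbabilityMeasure P] {p : ℕ}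
    (W : Ω → (Fin p → ℝ)) (A S Δ Y Y0 Y1 : Ω → ℝ)
    (hW : Measurable W) (hA : Measurable A) (hS : Measurable S)
    (hΔ : Measurable Δ) (hY : Measurable Y)
    (hY0 : Measurable Y0) (hY1 : Measurable Y1)
    (hA01 : ∀ ω, A ω = 0 ∨ A ω = 1) (hΔ01 : ∀ ω, Δ ω = 0 ∨ Δ ω = 1)
    (𝔪 𝔴 : MeasurableSpace Ω)
    (h𝔪 : 𝔪 = MeasurableSpace.comap (fun ω => (S ω, A ω, W ω)) inferInstance)
    (h𝔴 : 𝔴 = MeasurableSpace.comap W inferInstance)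
    (h𝔪le : 𝔪 ≤ mΩ) (h𝔴le : 𝔴 ≤ mΩ)
    -- consistency
    (hcons : ∀ ω, Y ω = A ω * Y1 ω + (1 - A ω) * Y0 ω)
    -- ignorability
    (hign : CondIndepFun 𝔴 h𝔴le A (fun ω => (Y0 ω, Y1 ω)) P)
    -- surrogate-mediated MAR
    (hMAR : CondIndepFun 𝔪 h𝔪le Δ Y P)
    (hY0int : Integrable Y0 P) (hY1int : Integrable Y1 P) (hYint : Integrable Y P)
    (gΔ : Ω → ℝ) (hgΔ : gΔ =ᵐ[P] P[Δ | 𝔪])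
    (e : Ω → ℝ) (he : e =ᵐ[P] P[A | 𝔴])
    -- treatment positivity
    (cA : ℝ) (hcA : 0 < cA) (hepos : ∀ᵐ ω ∂P, cA ≤ e ω ∧ e ω ≤ 1 - cA)
    -- censoring support positivity
    (cΔ : ℝ) (hcΔ : 0 < cΔ) (hgΔpos : ∀ᵐ ω ∂P, cΔ ≤ gΔ ω)
    -- arbitrary bounded outcome and intermediate models
    (Qhat : Ω → ℝ)
    (hQhatmeas :
      Measurable[MeasurableSpace.comap (fun ω => (S ω, W ω)) inferInstance] Qhat)
    (CQ : ℝ) (hQhatbd : ∀ ω, |Qhat ω| ≤ CQ)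
    (mhat : Ω → ℝ) (hmhatmeas : Measurable[𝔴] mhat)
    (Cm : ℝ) (hmhatbd : ∀ ω, |mhat ω| ≤ Cm) :
    ∫ ω, (A ω * Δ ω) / (e ω * gΔ ω) * (Y ω - Qhat ω)
        + (A ω / e ω) * (Qhat ω - mhat ω) + mhat ω ∂P
      = ∫ ω, Y1 ω ∂P := by
  have hAm : Measurable[𝔪] A := by
    rw [h𝔪]
    exact (measurable_fst.comp measurable_snd).comp (comap_measurable _)
  have h𝔴𝔪 : 𝔴 ≤ 𝔪 := by
    rw [h𝔴, h𝔪]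
    exact ((measurable_snd.comp measurable_snd).comp
      (comap_measurable fun ω => (S ω, A ω, W ω))).comap_le
  have hQm : Measurable[𝔪] Qhat := by
    refine hQhatmeas.mono (Measurable.comap_le ?_) le_rfl
    rw [h𝔪]
    exact (measurable_fst.prodMk (measurable_snd.comp measurable_snd)).comp (comap_measurable _)
  have hem : AEStronglyMeasurable[𝔴] e P :=
    stronglyMeasurable_condExp.aestronglyMeasurable.congr he.symm
  have hAbd : ∀ ω, ‖A ω‖ ≤ 1 := fun ω => by rcases hA01 ω with h | h <;> simp [h]
  have hΔbd : ∀ ω, ‖Δ ω‖ ≤ 1 := fun ω => by rcases hΔ01 ω with h | h <;> simp [h]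
  have hAe : AEStronglyMeasurable[𝔪] (fun ω => A ω / e ω) P :=
    hAm.stronglyMeasurable.aestronglyMeasurable.div₀ (hem.mono h𝔴𝔪)
  have hAebd : ∀ᵐ ω ∂P, ‖A ω / e ω‖ ≤ 1 / cA := by
    filter_upwards [hepos] with ω h using norm_div_le_div_of_le_of_le hcA h.1 (hAbd ω)
  have hAeQ : AEStronglyMeasurable[𝔪] (fun ω => A ω / e ω * Qhat ω) P :=
    hAe.mul hQm.stronglyMeasurable.aestronglyMeasurable
  have hAeQbd : ∀ᵐ ω ∂P, ‖A ω / e ω * Qhat ω‖ ≤ 1 / cA * CQ := by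
    filter_upwards [hAebd] with ω h using norm_mul_le_of_le h (hQhatbd ω)
  have hAY1 : CondIndepFun 𝔴 h𝔴le A Y1 P := hign.comp measurable_id measurable_snd
  have hepos' : ∀ᵐ ω ∂P, cA ≤ e ω := hepos.mono fun _ h => h.1
  obtain ⟨hint_Y, integral_Y⟩ := integral_inverse_weighting h𝔪le hΔ hY hMAR hΔbd hYint
    hgΔ hcΔ hgΔpos hAe hAebd
  obtain ⟨hint_Q, integral_Q⟩ := integral_inverse_weighting h𝔪le hΔ
    (measurable_const (a := (1 : ℝ))) (condIndepFun_const_right Δ 1) hΔbd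
    (integrable_const 1) hgΔ hcΔ hgΔpos hAeQ hAeQbd
  obtain ⟨-, integral_Y1⟩ := integral_inverse_weighting h𝔴le hA hY1 hAY1 hAbd hY1int he hcA
    hepos' (h := fun _ => 1) aestronglyMeasurable_const (C := 1) (by simp)
  obtain ⟨hint_mhat_weighted, integral_mhat⟩ := integral_inverse_weighting h𝔴le hA
    (measurable_const (a := (1 : ℝ))) (condIndepFun_const_right A 1) hAbd (integrable_const 1) he
    hcA hepos' hmhatmeas.stronglyMeasurable.aestronglyMeasurable
    (ae_of_all _ hmhatbd)
  have hint_AQ : Integrable (fun ω => A ω / e ω * Qhat ω) P :=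
    .of_bound (hAeQ.mono h𝔪le) _ hAeQbd
  have hint_mhat : Integrable mhat P :=
    .of_bound (hmhatmeas.mono h𝔴le le_rfl).aestronglyMeasurable _ (ae_of_all _ hmhatbd)
  have hAY : ∀ ω, A ω / e ω * Y ω = A ω / e ω * Y1 ω := fun ω => by
    rcases hA01 ω with h | h <;> simp [hcons ω, h]
  simp only [mul_one, hAY] at hint_Y hint_Q hint_mhat_weighted
  simp only [mul_one, one_mul, hAY] at integral_Y integral_Q integral_Y1 integral_mhat
  have hsplit : ∀ ω, (A ω * Δ ω) / (e ω * gΔ ω) * (Y ω - Qhat ω)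
      + (A ω / e ω) * (Qhat ω - mhat ω) + mhat ω
      = Δ ω / gΔ ω * (A ω / e ω * Y1 ω) - Δ ω / gΔ ω * (A ω / e ω * Qhat ω)
        + A ω / e ω * Qhat ω - A ω / e ω * mhat ω + mhat ω := fun ω => by
    rw [← hAY, mul_comm (A ω), mul_comm (e ω), mul_div_mul_comm]
    ring
  simp_rw [hsplit]
  have hint_YQ : Integrable (fun ω => Δ ω / gΔ ω * (A ω / e ω * Y1 ω)
      - Δ ω / gΔ ω * (A ω / e ω * Qhat ω)) P := hint_Y.sub hint_Q
  have hint_YQQ : Integrable (fun ω => Δ ω / gΔ ω * (A ω / e ω * Y1 ω)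
      - Δ ω / gΔ ω * (A ω / e ω * Qhat ω) + A ω / e ω * Qhat ω) P := hint_YQ.add hint_AQ
  have hint_sum : Integrable (fun ω => Δ ω / gΔ ω * (A ω / e ω * Y1 ω)
      - Δ ω / gΔ ω * (A ω / e ω * Qhat ω) + A ω / e ω * Qhat ω
      - A ω / e ω * mhat ω) P := hint_YQQ.sub hint_mhat_weighted
  rw [integral_add hint_sum hint_mhat, integral_sub hint_YQQ hint_mhat_weighted,
    integral_add hint_YQ hint_AQ, integral_sub hint_Y hint_Q, integral_Y, integral_Q,
    integral_Y1, integral_mhat]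
  ring
end
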